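/- arXiv:1909.10074 — 2 statements merged into one kernel-verified Lean document; each statement's English description precedes it below -/
import Mathlib

section
/- Let Φx ∈ ℝ^{(T+1)n×(T+1)n} and Φu ∈ ℝ^{(T+1)p×(T+1)n} be block lower triangular matrices satisfying (I − ZÂ)Φx − ZB̂Φu = I. Then Φx is invertible, the controller K := Φu Φx⁻¹ is block lower triangular, and K achieves the given system responses: (I − Z(Â+B̂K))⁻¹ = Φx and K(I − Z(Â+B̂K))⁻¹ = Φu. -/
open Matrix

/-- `Â = blkdiag(A, …, A, 0)`: block diagonal with `T` copies of `A` followed by a zero block. -/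
noncomputable def Ahat {n : ℕ} (T : ℕ) (A : Matrix (Fin n) (Fin n) ℝ) :
    Matrix (Fin (T + 1) × Fin n) (Fin (T + 1) × Fin n) ℝ :=
  fun si tj => if si.1 = tj.1 ∧ (si.1 : ℕ) < T then A si.2 tj.2 else 0

/-- `B̂ = blkdiag(B, …, B, 0)`: block diagonal with `T` copies of `B` followed by a zero block. -/
noncomputable def Bhat {n p : ℕ} (T : ℕ) (B : Matrix (Fin n) (Fin p) ℝ) :
    Matrix (Fin (T + 1) × Fin n) (Fin (T + 1) × Fin p) ℝ :=
  fun si tj => if si.1 = tj.1 ∧ (si.1 : ℕ) < T then B si.2 tj.2 else 0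

/-- The block-downshift matrix `Z`: identity blocks on the first block subdiagonal. -/
noncomputable def Zshift (T n : ℕ) :
    Matrix (Fin (T + 1) × Fin n) (Fin (T + 1) × Fin n) ℝ :=
  fun si tj => if (si.1 : ℕ) = (tj.1 : ℕ) + 1 ∧ si.2 = tj.2 then 1 else 0

/-- A block matrix (blocks indexed by times `0, …, T`) is block lower triangular if its
`(s, t)` block vanishes whenever `s < t`. -/
def BlockLowerTri {T a b : ℕ} (M : Matrix (Fin (T + 1) × Fin a) (Fin (T + 1) × Fin b) ℝ) :
    Prop :=
  ∀ (s t : Fin (T + 1)) (i : Fin a) (j : Fin b), (s : ℕ) < (t : ℕ) → M (s, i) (t, j) = 0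

/-- A block matrix is strictly block lower triangular if its `(s, t)` block vanishes
whenever `s ≤ t`. -/
def StrictBlockLowerTri {T a b : ℕ}
    (M : Matrix (Fin (T + 1) × Fin a) (Fin (T + 1) × Fin b) ℝ) : Prop :=
  ∀ (s t : Fin (T + 1)) (i : Fin a) (j : Fin b), (s : ℕ) ≤ (t : ℕ) → M (s, i) (t, j) = 0

theorem StrictBlockLowerTri.mul_blockLowerTri {T a b c : ℕ}
    {M : Matrix (Fin (T + 1) × Fin a) (Fin (T + 1) × Fin b) ℝ}
    {N : Matrix (Fin (T + 1) × Fin b) (Fin (T + 1) × Fin c) ℝ}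
    (hM : StrictBlockLowerTri M) (hN : BlockLowerTri N) : StrictBlockLowerTri (M * N) := by
  intro s t i j hst
  rw [Matrix.mul_apply]
  refine Finset.sum_eq_zero fun ⟨r, k⟩ _ => ?_
  rcases le_or_gt (s : ℕ) r with h | h
  · rw [hM s r i k h, zero_mul]
  · rw [hN r t k j (h.trans_le hst), mul_zero]

theorem BlockLowerTri.mul {T a b c : ℕ}
    {M : Matrix (Fin (T + 1) × Fin a) (Fin (T + 1) × Fin b) ℝ}
    {N : Matrix (Fin (T + 1) × Fin b) (Fin (T + 1) × Fin c) ℝ}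
    (hM : BlockLowerTri M) (hN : BlockLowerTri N) : BlockLowerTri (M * N) := by
  intro s t i j hst
  rw [Matrix.mul_apply]
  refine Finset.sum_eq_zero fun ⟨r, k⟩ _ => ?_
  rcases lt_or_ge (s : ℕ) r with h | h
  · rw [hM s r i k h, zero_mul]
  · rw [hN r t k j (h.trans_lt hst), mul_zero]

theorem strictBlockLowerTri_Zshift (T n : ℕ) : StrictBlockLowerTri (Zshift T n) :=
  fun _ _ _ _ hst => if_neg fun h => by
    have h1 := h.1
    dsimp only at h1
    omega

theorem blockLowerTri_Bhat {n p : ℕ} (T : ℕ) (B : Matrix (Fin n) (Fin p) ℝ) :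
    BlockLowerTri (Bhat T B) :=
  fun _ _ _ _ hst => if_neg fun h => hst.ne (congrArg Fin.val h.1)

theorem blockLowerTri_Ahat {n : ℕ} (T : ℕ) (A : Matrix (Fin n) (Fin n) ℝ) :
    BlockLowerTri (Ahat T A) :=
  blockLowerTri_Bhat T A

theorem blockLowerTri_iff_blockTriangular {T n : ℕ}
    {M : Matrix (Fin (T + 1) × Fin n) (Fin (T + 1) × Fin n) ℝ} :
    BlockLowerTri M ↔ M.BlockTriangular fun i => OrderDual.toDual i.1 :=
  ⟨fun h i j hij => h i.1 j.1 i.2 j.2 hij, fun h s t i j hst => @h (s, i) (t, j) hst⟩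

theorem BlockLowerTri.inv {T n : ℕ}
    {M : Matrix (Fin (T + 1) × Fin n) (Fin (T + 1) × Fin n) ℝ}
    (hM : BlockLowerTri M) (hu : IsUnit M) : BlockLowerTri M⁻¹ := by
  let := hu.invertible
  exact blockLowerTri_iff_blockTriangular.2
    (blockTriangular_inv_of_blockTriangular (blockLowerTri_iff_blockTriangular.1 hM))

/-- The identity plus a strictly block lower triangular matrix is invertible. -/
theorem StrictBlockLowerTri.isUnit_one_add {T n : ℕ}
    {N : Matrix (Fin (T + 1) × Fin n) (Fin (T + 1) × Fin n) ℝ}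
    (hN : StrictBlockLowerTri N) : IsUnit (1 + N) := by
  have hlow : BlockLowerTri (1 + N) := by
    intro s t i j hst
    have hne : (s, i) ≠ (t, j) := fun h => hst.ne (congrArg (fun x => (x.1 : ℕ)) h)
    rw [Matrix.add_apply, Matrix.one_apply_ne hne, hN s t i j hst.le, add_zero]
  rw [Matrix.isUnit_iff_isUnit_det, (blockLowerTri_iff_blockTriangular.1 hlow).det_fintype,
    Finset.prod_eq_one]
  · exact isUnit_one
  intro k _
  have hblock : (1 + N).toSquareBlock (fun i => OrderDual.toDual i.1) k = 1 := by
    ext ⟨⟨s, i⟩, hs⟩ ⟨⟨t, j⟩, ht⟩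
    have hst : s = t := OrderDual.toDual.injective (hs.trans ht.symm)
    simp [Matrix.toSquareBlock_def, Matrix.one_apply, hN s t i j (by rw [hst])]
  rw [hblock, Matrix.det_one]

/-- if block lower triangular `Φx`, `Φu` satisfy `(I - ZÂ) Φx - ZB̂ Φu = I`, then
`Φx` is invertible, the controller `K := Φu Φx⁻¹` is block lower triangular, and `K` achieves
the given system responses: `(I - Z(Â + B̂K))⁻¹ = Φx` and `K (I - Z(Â + B̂K))⁻¹ = Φu`. -/
theorem sls_controller_realization {n p T : ℕ}
    (A : Matrix (Fin n) (Fin n) ℝ) (B : Matrix (Fin n) (Fin p) ℝ)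
    (Phix : Matrix (Fin (T + 1) × Fin n) (Fin (T + 1) × Fin n) ℝ)
    (Phiu : Matrix (Fin (T + 1) × Fin p) (Fin (T + 1) × Fin n) ℝ)
    (hx : BlockLowerTri Phix) (hu : BlockLowerTri Phiu)
    (hach : (1 - Zshift T n * Ahat T A) * Phix - Zshift T n * Bhat T B * Phiu = 1) :
    IsUnit Phix ∧
    BlockLowerTri (Phiu * Phix⁻¹) ∧
    (1 - Zshift T n * (Ahat T A + Bhat T B * (Phiu * Phix⁻¹)))⁻¹ = Phix ∧
    (Phiu * Phix⁻¹) * (1 - Zshift T n * (Ahat T A + Bhat T B * (Phiu * Phix⁻¹)))⁻¹ = Phiu := by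
  have hPhix : Phix = 1 + Zshift T n * (Ahat T A * Phix + Bhat T B * Phiu) := by
    rw [← hach, sub_mul, one_mul, Matrix.mul_add, Matrix.mul_assoc, Matrix.mul_assoc]
    abel
  have hunit : IsUnit Phix := by
    rw [hPhix]
    refine ((strictBlockLowerTri_Zshift T n).mul_blockLowerTri fun s t i j hst => ?_).isUnit_one_add
    rw [Matrix.add_apply, (blockLowerTri_Ahat T A).mul hx s t i j hst,
      (blockLowerTri_Bhat T B).mul hu s t i j hst, add_zero]
  have hK : Phiu * Phix⁻¹ * Phix = Phiu :=
    Matrix.nonsing_inv_mul_cancel_right _ _ ((Matrix.isUnit_iff_isUnit_det _).1 hunit)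
  have hinv : (1 - Zshift T n * (Ahat T A + Bhat T B * (Phiu * Phix⁻¹)))⁻¹ = Phix := by
    refine Matrix.inv_eq_right_inv ?_
    rw [sub_mul, one_mul, Matrix.mul_assoc, add_mul, Matrix.mul_assoc (Bhat T B), hK]
    exact sub_eq_of_eq_add hPhix
  exact ⟨hunit, hu.mul (hx.inv hunit), hinv, by rw [hinv, hK]⟩
end

section
/- Equivalence of the MPC problem and its SLS reformulation for a fixed nonzero initial condition: let x0 ∈ ℝⁿ with x0 ≠ 0, let X ⊆ ℝ^{(T+1)n} and U ⊆ ℝ^{(T+1)p} be arbitrary sets, and let f : ℝ^{(T+1)n} × ℝ^{(T+1)p} → ℝ be an arbitrary function. Then the set of objective values {f(x,u) : x = ZÂx + ZB̂u + E1x0, x ∈ X, u ∈ U} equals the set of objective values {f(Φx x0, Φu x0) : (I − ZÂ)Φx − ZB̂Φu = E1, Φx x0 ∈ X, Φu x0 ∈ U, Φx ∈ ℝ^{(T+1)n×n}, Φu ∈ ℝ^{(T+1)p×n}}; in particular the infima of the two optimization problems coincide. -/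
open Matrix

/-- `E1`: block-column matrix whose first `n × n` block is the identity, remaining blocks 0. -/
noncomputable def E1mat (T n : ℕ) : Matrix (Fin (T + 1) × Fin n) (Fin n) ℝ :=
  fun ti j => if (ti.1 : ℕ) = 0 ∧ ti.2 = j then 1 else 0

/-- The product of the downshift and a block diagonal matrix is strictly block lower triangular. -/
theorem strictBlockLowerTri_Zshift_mul_Ahat {n : ℕ} (T : ℕ) (A : Matrix (Fin n) (Fin n) ℝ) :
    StrictBlockLowerTri (Zshift T n * Ahat T A) := by
  intro s t i j hst
  rw [Matrix.mul_apply]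
  refine Finset.sum_eq_zero fun r _ => ?_
  unfold Zshift Ahat
  by_cases h : r.1 = t
  · have : ¬ (s : ℕ) = (r.1 : ℕ) + 1 := by rw [h]; omega
    simp [this]
  · simp [h]

/-- `1 - M` is invertible when `M` is strictly block lower triangular. -/
theorem StrictBlockLowerTri.isUnit_one_sub {T n : ℕ}
    {M : Matrix (Fin (T + 1) × Fin n) (Fin (T + 1) × Fin n) ℝ} (hM : StrictBlockLowerTri M) :
    IsUnit (1 - M) := by
  rw [← Matrix.mulVec_injective_iff_isUnit]
  refine (injective_iff_map_eq_zero (1 - M).mulVecLin).2 fun v hv => ?_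
  have hv' : v = M *ᵥ v := by
    rw [Matrix.mulVecLin_apply, Matrix.sub_mulVec, Matrix.one_mulVec] at hv
    exact sub_eq_zero.1 hv
  have key : ∀ (k : ℕ) (s : Fin (T + 1)) (i : Fin n), (s : ℕ) = k → v (s, i) = 0 := by
    intro k
    induction k using Nat.strong_induction_on with
    | _ k ih =>
      intro s i hs
      rw [hv']
      change ∑ r, M (s, i) r * v r = 0
      refine Finset.sum_eq_zero fun r _ => ?_
      rcases Nat.lt_or_ge (r.1 : ℕ) s with h | h
      · rw [ih r.1 (hs ▸ h) r.1 r.2 rfl, mul_zero]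
      · rw [hM s r.1 i r.2 h, zero_mul]
  exact funext fun r => key r.1 r.1 r.2 rfl

/-- Every vector is the image of a given nonzero vector under some matrix. -/
theorem exists_matrix_mulVec_eq {m ι : Type*} [Fintype ι] {x : ι → ℝ} (hx : x ≠ 0) (u : m → ℝ) :
    ∃ P : Matrix m ι ℝ, P *ᵥ x = u := by
  have hxx : x ⬝ᵥ x ≠ 0 := fun h => hx (dotProduct_self_eq_zero.1 h)
  refine ⟨Matrix.vecMulVec u ((x ⬝ᵥ x)⁻¹ • x), ?_⟩
  rw [Matrix.vecMulVec_mulVec, smul_dotProduct, smul_eq_mul, inv_mul_cancel₀ hxx,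
    MulOpposite.op_one, one_smul]

/-- equivalence of the MPC problem and its SLS reformulation for a fixed
nonzero initial condition: the set of objective values of the MPC problem equals the set of
objective values of the SLS reformulation; in particular the infima coincide. -/
theorem mpc_sls_objective_values_eq {n p T : ℕ}
    (A : Matrix (Fin n) (Fin n) ℝ) (B : Matrix (Fin n) (Fin p) ℝ)
    (x0 : Fin n → ℝ) (hx0 : x0 ≠ 0)
    (X : Set (Fin (T + 1) × Fin n → ℝ)) (U : Set (Fin (T + 1) × Fin p → ℝ))
    (f : (Fin (T + 1) × Fin n → ℝ) → (Fin (T + 1) × Fin p → ℝ) → ℝ) :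
    {v : ℝ | ∃ (x : Fin (T + 1) × Fin n → ℝ) (u : Fin (T + 1) × Fin p → ℝ),
        x = (Zshift T n * Ahat T A).mulVec x + (Zshift T n * Bhat T B).mulVec u +
            (E1mat T n).mulVec x0 ∧
        x ∈ X ∧ u ∈ U ∧ v = f x u} =
      {v : ℝ | ∃ (Phix : Matrix (Fin (T + 1) × Fin n) (Fin n) ℝ)
          (Phiu : Matrix (Fin (T + 1) × Fin p) (Fin n) ℝ),
        (1 - Zshift T n * Ahat T A) * Phix - Zshift T n * Bhat T B * Phiu = E1mat T n ∧
        Phix.mulVec x0 ∈ X ∧ Phiu.mulVec x0 ∈ U ∧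
        v = f (Phix.mulVec x0) (Phiu.mulVec x0)} ∧
    sInf {v : ℝ | ∃ (x : Fin (T + 1) × Fin n → ℝ) (u : Fin (T + 1) × Fin p → ℝ),
        x = (Zshift T n * Ahat T A).mulVec x + (Zshift T n * Bhat T B).mulVec u +
            (E1mat T n).mulVec x0 ∧
        x ∈ X ∧ u ∈ U ∧ v = f x u} =
      sInf {v : ℝ | ∃ (Phix : Matrix (Fin (T + 1) × Fin n) (Fin n) ℝ)
          (Phiu : Matrix (Fin (T + 1) × Fin p) (Fin n) ℝ),
        (1 - Zshift T n * Ahat T A) * Phix - Zshift T n * Bhat T B * Phiu = E1mat T n ∧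
        Phix.mulVec x0 ∈ X ∧ Phiu.mulVec x0 ∈ U ∧
        v = f (Phix.mulVec x0) (Phiu.mulVec x0)} := by
  refine (fun h => ⟨h, congrArg sInf h⟩) ?_
  have hN := (strictBlockLowerTri_Zshift_mul_Ahat T A).isUnit_one_sub
  ext v
  constructor
  · rintro ⟨x, u, hx, hX, hU, rfl⟩
    obtain ⟨Phiu, rfl⟩ := exists_matrix_mulVec_eq hx0 u
    obtain ⟨Phix, hPhix⟩ : ∃ Phix, (1 - Zshift T n * Ahat T A) * Phix =
        E1mat T n + Zshift T n * Bhat T B * Phiu :=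
      ⟨(1 - Zshift T n * Ahat T A)⁻¹ * (E1mat T n + Zshift T n * Bhat T B * Phiu),
        Matrix.mul_nonsing_inv_cancel_left _ _ ((Matrix.isUnit_iff_isUnit_det _).1 hN)⟩
    have hPx : Phix *ᵥ x0 = x := by
      apply Matrix.mulVec_injective_of_isUnit hN
      rw [Matrix.mulVec_mulVec, hPhix, Matrix.add_mulVec, ← Matrix.mulVec_mulVec,
        Matrix.sub_mulVec, Matrix.one_mulVec, eq_sub_iff_add_eq]
      conv_rhs => rw [hx]
      abel
    exact ⟨Phix, Phiu, by rw [hPhix, add_sub_cancel_right], hPx.symm ▸ hX, hU, by rw [hPx]⟩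
  · rintro ⟨Phix, Phiu, h, hX, hU, rfl⟩
    refine ⟨_, _, ?_, hX, hU, rfl⟩
    rw [← h, Matrix.sub_mulVec, Matrix.sub_mul, Matrix.one_mul, Matrix.sub_mulVec,
      Matrix.mulVec_mulVec, Matrix.mulVec_mulVec]
    abel
end
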